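/- There exists a constant C > 0, depending only on ν and μ, such that for every u₀ in the Schwartz class on ℝ one has ‖S(t) u₀‖_{L⁸_{xt}(ℝ²)} ≤ C ‖u₀‖_{L²(ℝ)}. (L⁸ Strichartz estimate for the Benjamin group, Lemma 2.1, estimate (2.5).) -/

import Mathlib

open MeasureTheory Real
open scoped ENNReal NNReal Classical

noncomputable section

/-- Phase function of the linear Benjamin equation: `φ(ξ) = -ν ξ|ξ| + μ ξ³`. -/
def phase (ν μ ξ : ℝ) : ℝ := -ν * ξ * |ξ| + μ * ξ ^ 3

/-- Derivative of the phase: `φ'(ξ) = -2ν|ξ| + 3μξ²`. -/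
def dphase (ν μ ξ : ℝ) : ℝ := -2 * ν * |ξ| + 3 * μ * ξ ^ 2

/-- The frequency threshold `a = 2·max(1, |2ν/(3μ)|)`. -/
def aconst (ν μ : ℝ) : ℝ := 2 * max 1 |2 * ν / (3 * μ)|

/-- Fourier transform in the space variable. -/
def FT (f : ℝ → ℂ) (ξ : ℝ) : ℂ := ∫ x : ℝ, Complex.exp (-(Complex.I * ξ * x)) * f x

/-- Space-time Fourier transform. -/
def FT2 (u : ℝ → ℝ → ℂ) (ξ τ : ℝ) : ℂ :=
  ∫ x : ℝ, ∫ t : ℝ, Complex.exp (-(Complex.I * (ξ * x + τ * t))) * u x t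

/-- Mixed norm `‖f‖_{L^p_x L^q_t}` (with exponents in `ℝ≥0∞`). -/
def mixedLpLq (p q : ℝ≥0∞) (f : ℝ → ℝ → ℂ) : ℝ≥0∞ :=
  if p = ∞ then essSup (fun x => eLpNorm (f x) q volume) volume
  else (∫⁻ x : ℝ, eLpNorm (f x) q volume ^ p.toReal) ^ (1 / p.toReal)

/-- The Bourgain norm `‖u‖_{X_{s,b}}` associated to the Benjamin phase function. -/
def XNorm (ν μ s b : ℝ) (u : ℝ → ℝ → ℂ) : ℝ≥0∞ :=
  (∫⁻ ξ : ℝ, ∫⁻ τ : ℝ,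
      ENNReal.ofReal ((1 + ξ ^ 2) ^ s * (1 + (τ - phase ν μ ξ) ^ 2) ^ b) *
        (‖FT2 u ξ τ‖₊ : ℝ≥0∞) ^ 2) ^ (1 / 2 : ℝ)

/-- The free Benjamin group `S(t)` applied to initial data `u₀`, as a function of `(x,t)`. -/
def Sgrp (ν μ : ℝ) (u₀ : ℝ → ℂ) (x t : ℝ) : ℂ :=
  (2 * π)⁻¹ • ∫ ξ : ℝ, Complex.exp (Complex.I * (ξ * x + phase ν μ ξ * t)) * FT u₀ ξ

/-- `D_x^α S(t) P^a u₀` : the Benjamin group composed with the Fourier restriction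
`P^a` to `{|ξ| ≥ a}` and the derivative operator `D_x^α`. -/
def DSgrpPa (ν μ α : ℝ) (u₀ : ℝ → ℂ) (x t : ℝ) : ℂ :=
  (2 * π)⁻¹ • ∫ ξ : ℝ,
    if aconst ν μ ≤ |ξ| then
      (↑(|ξ| ^ α) : ℂ) * Complex.exp (Complex.I * (ξ * x + phase ν μ ξ * t)) * FT u₀ ξ
    else 0

/-- `D_x^α P^a F` acting in the space variable of a space-time function `F`. -/
def DPa (ν μ α : ℝ) (F : ℝ → ℝ → ℂ) (x t : ℝ) : ℂ :=
  (2 * π)⁻¹ • ∫ ξ : ℝ,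
    if aconst ν μ ≤ |ξ| then
      (↑(|ξ| ^ α) : ℂ) * Complex.exp (Complex.I * (ξ * x)) * FT (fun y => F y t) ξ
    else 0

theorem lintegral_comp_abs (F : ℝ → ℝ≥0∞) :
    ∫⁻ z, F |z| = 2 * ∫⁻ z in Set.Ioi 0, F z := by
  have h1 : ∫⁻ z in Set.Ioi (0 : ℝ), F |z| = ∫⁻ z in Set.Ioi 0, F z :=
    setLIntegral_congr_fun measurableSet_Ioi fun z hz => by rw [abs_of_pos hz]
  have h2 : ∫⁻ z in (Set.Ioi (0 : ℝ))ᶜ, F |z| = ∫⁻ z in Set.Ioi 0, F |z| := by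
    rw [Set.compl_Ioi, ← restrict_Iio_eq_restrict_Iic,
      ← (Measure.measurePreserving_neg (volume : Measure ℝ)).setLIntegral_comp_preimage_emb
        (MeasurableEquiv.neg ℝ).measurableEmbedding]
    simp
  rw [← lintegral_add_compl _ (measurableSet_Ioi (a := (0 : ℝ))), h2, h1, two_mul]

/-- The kernel of the fractional integral of order `1/3`. -/
def rieszKernel (z : ℝ) : ℝ≥0∞ := ENNReal.ofReal (|z| ^ (-(2 / 3) : ℝ))

@[fun_prop]
theorem measurable_rieszKernel : Measurable rieszKernel := by
  unfold rieszKernel; fun_prop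

theorem lintegral_rieszKernel_near (s : ℝ) (hs : 0 < s) :
    ∫⁻ z, {z | |z| < s ^ 3}.indicator rieszKernel z = ENNReal.ofReal (6 * s) := by
  have hr : 0 < s ^ 3 := by positivity
  have h := lintegral_comp_abs
    ((Set.Iio (s ^ 3)).indicator fun z => ENNReal.ofReal (z ^ (-(2 / 3) : ℝ)))
  have e : ∀ z : ℝ, {z | |z| < s ^ 3}.indicator rieszKernel z =
      (Set.Iio (s ^ 3)).indicator (fun z => ENNReal.ofReal (z ^ (-(2 / 3) : ℝ))) |z| := by
    intro z; simp [Set.indicator, rieszKernel]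
  simp_rw [e, h]
  rw [lintegral_indicator measurableSet_Iio, Measure.restrict_restrict measurableSet_Iio,
    Set.inter_comm, Set.Ioi_inter_Iio, Measure.restrict_congr_set Ioo_ae_eq_Ioc,
    ← ofReal_integral_eq_lintegral_ofReal,
    ← intervalIntegral.integral_of_le hr.le, integral_rpow (by norm_num)]
  · rw [← Real.rpow_natCast, ← Real.rpow_mul hs.le, ← ENNReal.ofReal_ofNat,
      ← ENNReal.ofReal_mul (by norm_num)]
    congr 1
    norm_num
    ring
  · exact (intervalIntegral.intervalIntegrable_rpow' (by norm_num)).1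
  · exact (ae_restrict_iff' measurableSet_Ioc).2
      (Filter.Eventually.of_forall fun z hz => Real.rpow_nonneg hz.1.le _)

theorem lintegral_rieszKernel_far (s : ℝ) (hs : 0 < s) :
    ∫⁻ z, {z | s ^ 3 ≤ |z|}.indicator rieszKernel z ^ (3 : ℝ) =
      ENNReal.ofReal (2 * (s ^ 3)⁻¹) := by
  have hr : 0 < s ^ 3 := by positivity
  have h := lintegral_comp_abs
    ((Set.Ici (s ^ 3)).indicator fun z => ENNReal.ofReal (z ^ (-2 : ℝ)))
  have e : ∀ z : ℝ, {z | s ^ 3 ≤ |z|}.indicator rieszKernel z ^ (3 : ℝ) =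
      (Set.Ici (s ^ 3)).indicator (fun z => ENNReal.ofReal (z ^ (-2 : ℝ))) |z| := by
    intro z
    by_cases hz : s ^ 3 ≤ |z|
    · have : 0 < |z| := hr.trans_le hz
      simp only [Set.indicator, rieszKernel, Set.mem_ofPred_eq, hz, if_true, Set.mem_Ici]
      rw [ENNReal.ofReal_rpow_of_pos (by positivity), ← Real.rpow_mul this.le]
      norm_num
    · simp [Set.indicator, hz]
  simp_rw [e, h]
  rw [lintegral_indicator measurableSet_Ici, Measure.restrict_restrict measurableSet_Ici,
    Set.inter_eq_left.2 (Set.Ici_subset_Ioi.2 hr), ← restrict_Ioi_eq_restrict_Ici,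
    ← ofReal_integral_eq_lintegral_ofReal, integral_Ioi_rpow_of_lt (by norm_num) hr]
  · rw [← ENNReal.ofReal_ofNat, ← ENNReal.ofReal_mul (by norm_num)]
    norm_num [Real.rpow_neg_one]
  · exact integrableOn_Ioi_rpow_of_lt (by norm_num) hr
  · exact (ae_restrict_iff' measurableSet_Ioi).2
      (Filter.Eventually.of_forall fun z hz => Real.rpow_nonneg (hr.trans hz).le _)

theorem lintegral_mul_rieszKernel_le_add (g : ℝ → ℝ≥0∞) (hg : Measurable g) (b : ℝ≥0∞) (y s : ℝ)
    (hs : 0 < s) :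
    ∫⁻ x, {x | g x ≤ b}.indicator g x * rieszKernel (x - y) ≤
      b * ENNReal.ofReal (6 * s) +
        (∫⁻ x, g x ^ (3 / 2 : ℝ)) ^ (2 / 3 : ℝ) * ENNReal.ofReal (2 * s⁻¹) := by
  calc _ ≤ ∫⁻ x, (b * {z | |z| < s ^ 3}.indicator rieszKernel (x - y) +
        g x * {z | s ^ 3 ≤ |z|}.indicator rieszKernel (x - y)) := by
        refine lintegral_mono fun x => ?_
        by_cases h1 : g x ≤ b <;> by_cases h2 : |x - y| < s ^ 3
        · simp only [Set.indicator, Set.mem_ofPred_eq, h1, h2, if_true]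
          exact le_add_right (by gcongr)
        · simp [Set.indicator, h1, h2, not_lt.1 h2]
        · simp [Set.indicator, h1]
        · simp [Set.indicator, h1]
    _ = (∫⁻ x, b * {z | |z| < s ^ 3}.indicator rieszKernel (x - y)) +
        ∫⁻ x, g x * {z | s ^ 3 ≤ |z|}.indicator rieszKernel (x - y) := by
        refine lintegral_add_left (Measurable.const_mul ?_ _) _
        exact (measurable_rieszKernel.indicator
          (measurableSet_lt (by fun_prop) (by fun_prop))).comp (by fun_prop)
    _ ≤ _ := by
        have m : Measurable ({z | s ^ 3 ≤ |z|}.indicator rieszKernel) :=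
          measurable_rieszKernel.indicator (measurableSet_le (by fun_prop) (by fun_prop))
        have m' : Measurable ({z | |z| < s ^ 3}.indicator rieszKernel) :=
          measurable_rieszKernel.indicator (measurableSet_lt (by fun_prop) (by fun_prop))
        gcongr ?_ + ?_
        · have m'' : Measurable fun x => {z | |z| < s ^ 3}.indicator rieszKernel (x - y) :=
            m'.comp (measurable_id.sub_const y)
          rw [lintegral_const_mul _ m'',
            lintegral_sub_right_eq_self ({z | |z| < s ^ 3}.indicator rieszKernel),
            lintegral_rieszKernel_near s hs]
        · refine (ENNReal.lintegral_mul_le_Lp_mul_Lq (p := 3 / 2) (q := 3) volume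
            ((Real.holderConjugate_iff).2 (by norm_num)) hg.aemeasurable
            (m.comp (by fun_prop : Measurable fun x : ℝ => x - y)).aemeasurable).trans ?_
          have := lintegral_sub_right_eq_self (μ := volume)
            (fun z => {z | s ^ 3 ≤ |z|}.indicator rieszKernel z ^ (3 : ℝ)) y
          simp only [Function.comp_def]
          rw [this, lintegral_rieszKernel_far s hs]
          have e : (1 : ℝ) / (3 / 2) = 2 / 3 := by norm_num
          rw [e]
          gcongr
          rw [ENNReal.ofReal_rpow_of_pos (by positivity)]
          refine ENNReal.ofReal_le_ofReal ?_
          rw [Real.mul_rpow (by norm_num) (by positivity), Real.inv_rpow (by positivity),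
            ← Real.rpow_natCast, ← Real.rpow_mul hs.le]
          norm_num
          refine mul_le_mul_of_nonneg_right ?_ (by positivity)
          calc (2 : ℝ) ^ (1 / 3 : ℝ) ≤ 2 ^ (1 : ℝ) :=
                Real.rpow_le_rpow_of_exponent_le (by norm_num) (by norm_num)
            _ = 2 := by norm_num

theorem lintegral_mul_rieszKernel_le (g : ℝ → ℝ≥0∞) (hg : Measurable g) (b : ℝ≥0∞) (y : ℝ) :
    ∫⁻ x, {x | g x ≤ b}.indicator g x * rieszKernel (x - y) ≤
      8 * (∫⁻ x, g x ^ (3 / 2 : ℝ)) ^ (1 / 3 : ℝ) * b ^ (1 / 2 : ℝ) := by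
  set M := ∫⁻ x, g x ^ (3 / 2 : ℝ) with hM
  rcases eq_or_ne b 0 with rfl | hb0
  · refine le_of_eq_of_le ?_ zero_le
    rw [lintegral_eq_zero_iff (by
      refine Measurable.mul (hg.indicator (measurableSet_le hg (by fun_prop))) (by fun_prop))]
    refine Filter.Eventually.of_forall fun x => ?_
    by_cases h : g x = 0 <;> simp [Set.indicator, h]
  rcases eq_or_ne M 0 with hM0 | hM0
  · refine le_of_eq_of_le ?_ zero_le
    rw [hM, lintegral_eq_zero_iff (by fun_prop)] at hM0
    rw [lintegral_eq_zero_iff (by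
      refine Measurable.mul (hg.indicator (measurableSet_le hg (by fun_prop))) (by fun_prop))]
    filter_upwards [hM0] with x hx
    have : g x = 0 := by
      rcases ENNReal.rpow_eq_zero_iff.1 hx with h | h
      · exact h.1
      · norm_num at h
    simp [Set.indicator, this]
  rcases eq_or_ne b ∞ with rfl | hb
  · rw [ENNReal.top_rpow_of_pos (by norm_num), ENNReal.mul_top]
    · exact le_top
    · simp [ENNReal.rpow_eq_zero_iff, hM0]
  rcases eq_or_ne M ∞ with hMt | hMt
  · rw [hMt, ENNReal.top_rpow_of_pos (by norm_num), ENNReal.mul_top (by norm_num),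
      ENNReal.top_mul]
    · exact le_top
    · simp [ENNReal.rpow_eq_zero_iff, hb0, hb]
  have hm : 0 < M.toReal := ENNReal.toReal_pos hM0 hMt
  have hβ : 0 < b.toReal := ENNReal.toReal_pos hb0 hb
  have h := lintegral_mul_rieszKernel_le_add g hg b y
    (M.toReal ^ (1 / 3 : ℝ) * b.toReal ^ (-(1 / 2) : ℝ)) (by positivity)
  rw [← hM] at h
  refine h.trans (le_of_eq ?_)
  rw [← ENNReal.ofReal_toReal hb, ← ENNReal.ofReal_toReal hMt]
  generalize M.toReal = m at *
  generalize b.toReal = β at *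
  rw [ENNReal.toReal_ofReal hm.le, ENNReal.toReal_ofReal hβ.le,
    ENNReal.ofReal_rpow_of_pos hm, ENNReal.ofReal_rpow_of_pos hm, ENNReal.ofReal_rpow_of_pos hβ,
    ← ENNReal.ofReal_mul hβ.le, ← ENNReal.ofReal_mul (by positivity),
    ← ENNReal.ofReal_add (by positivity) (by positivity), ← ENNReal.ofReal_ofNat,
    ← ENNReal.ofReal_mul (by positivity), ← ENNReal.ofReal_mul (by positivity)]
  congr 1
  have e1 : β = β ^ (1 / 2 : ℝ) * β ^ (1 / 2 : ℝ) := by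
    rw [← Real.rpow_add hβ]; norm_num
  have e2 : m ^ (2 / 3 : ℝ) = m ^ (1 / 3 : ℝ) * m ^ (1 / 3 : ℝ) := by
    rw [← Real.rpow_add hm]; norm_num
  rw [e2, Real.rpow_neg hβ.le]
  have := Real.rpow_pos_of_pos hβ (1 / 2)
  have := Real.rpow_pos_of_pos hm (1 / 3)
  nth_rewrite 1 [e1]
  field_simp
  norm_num

/-- The diagonal Hardy–Littlewood–Sobolev inequality on the line with kernel `|x - y|^(-2/3)`. -/
theorem hardyLittlewoodSobolev (g : ℝ → ℝ≥0∞) (hg : Measurable g) :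
    ∫⁻ y, ∫⁻ x, g x * g y * rieszKernel (x - y) ≤
      16 * (∫⁻ x, g x ^ (3 / 2 : ℝ)) ^ (4 / 3 : ℝ) := by
  set M := ∫⁻ x, g x ^ (3 / 2 : ℝ) with hM
  have hk : ∀ x y, rieszKernel (x - y) = rieszKernel (y - x) := fun x y => by
    simp [rieszKernel, abs_sub_comm]
  have key : ∫⁻ y, ∫⁻ x, {x | g x ≤ g y}.indicator g x * rieszKernel (x - y) * g y ≤
      8 * M ^ (4 / 3 : ℝ) := by
    calc _ ≤ ∫⁻ y, 8 * M ^ (1 / 3 : ℝ) * g y ^ (3 / 2 : ℝ) := by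
          refine lintegral_mono fun y => ?_
          rw [lintegral_mul_const _ (by
            refine Measurable.mul (hg.indicator (measurableSet_le hg (by fun_prop)))
              (by fun_prop))]
          refine (mul_le_mul_left (lintegral_mul_rieszKernel_le g hg (g y) y) _).trans
            (le_of_eq ?_)
          rw [mul_assoc]
          congr 1
          nth_rewrite 2 [← ENNReal.rpow_one (g y)]
          rw [← ENNReal.rpow_add_of_nonneg _ _ (by norm_num) (by norm_num)]
          norm_num
      _ = _ := by
          rw [lintegral_const_mul _ (by fun_prop), ← hM, mul_assoc]
          congr 1
          nth_rewrite 2 [← ENNReal.rpow_one M]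
          rw [← ENNReal.rpow_add_of_nonneg _ _ (by norm_num) (by norm_num)]
          norm_num
  have hmeas : Measurable fun p : ℝ × ℝ =>
      {x | g x ≤ g p.1}.indicator g p.2 * rieszKernel (p.2 - p.1) * g p.1 := by
    have : Measurable fun p : ℝ × ℝ => {x | g x ≤ g p.1}.indicator g p.2 :=
      Measurable.ite (measurableSet_le (hg.comp measurable_snd) (hg.comp measurable_fst))
        (hg.comp measurable_snd) measurable_const
    fun_prop
  calc _ ≤ ∫⁻ y, ∫⁻ x, ({x | g x ≤ g y}.indicator g x * rieszKernel (x - y) * g y +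
        {y | g y ≤ g x}.indicator g y * rieszKernel (y - x) * g x) := by
        refine lintegral_mono fun y => lintegral_mono fun x => ?_
        rcases le_total (g x) (g y) with h | h
        · refine le_add_right (le_of_eq ?_)
          simp only [Set.indicator, Set.mem_ofPred_eq, h, if_true]; ring
        · refine le_add_left (le_of_eq ?_)
          simp only [Set.indicator, Set.mem_ofPred_eq, h, if_true]; rw [hk x y]; ring
    _ = (∫⁻ y, ∫⁻ x, {x | g x ≤ g y}.indicator g x * rieszKernel (x - y) * g y) +
        ∫⁻ y, ∫⁻ x, {y | g y ≤ g x}.indicator g y * rieszKernel (y - x) * g x := by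
        rw [← lintegral_add_left hmeas.lintegral_prod_right]
        refine lintegral_congr fun y => lintegral_add_left ?_ _
        exact hmeas.comp measurable_prodMk_left
    _ ≤ 8 * M ^ (4 / 3 : ℝ) + 8 * M ^ (4 / 3 : ℝ) := by
        refine add_le_add key ?_
        exact (lintegral_lintegral_swap (f := fun y x => {y | g y ≤ g x}.indicator g y *
          rieszKernel (y - x) * g x) (hmeas.comp measurable_swap).aemeasurable).trans_le key
    _ = _ := by rw [← add_mul]; norm_num

section HausdorffYoung

open scoped FourierTransform ComplexConjugate

variable {V : Type*} [NormedAddCommGroup V] [InnerProductSpace ℝ V] [FiniteDimensional ℝ V]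
  [MeasurableSpace V] [BorelSpace V]

theorem continuous_fourier {G : V → ℂ} (hG : Integrable G) : Continuous (𝓕 G) :=
  VectorFourier.fourierIntegral_continuous Real.continuous_fourierChar
    (by exact continuous_inner) hG

theorem lintegral_enorm_fourier_gaussian {b : ℝ} (hb : 0 < b) :
    ∫⁻ v, ‖𝓕 (fun v : V => Complex.exp (-b * ‖v‖ ^ 2)) v‖ₑ = 1 := by
  have e : ∀ w : V, ‖𝓕 (fun v : V => Complex.exp (-b * ‖v‖ ^ 2)) w‖ =
      (π / b) ^ (Module.finrank ℝ V / 2 : ℝ) * Real.exp (-(π ^ 2 / b) * ‖w‖ ^ 2) := by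
    intro w
    rw [fourier_gaussian_innerProductSpace (by simpa using hb), norm_mul, Complex.norm_exp]
    congr 1
    · rw [← Complex.ofReal_div]
      have := Complex.norm_cpow_eq_rpow_re_of_pos (div_pos pi_pos hb) (Module.finrank ℝ V / 2 : ℂ)
      rw [this]
      congr 1
      rw [show (Module.finrank ℝ V / 2 : ℂ) = ((Module.finrank ℝ V / 2 : ℝ) : ℂ) by push_cast; rfl]
      exact Complex.ofReal_re _
    · congr 1
      rw [show (-π ^ 2 * ‖w‖ ^ 2 / b : ℂ) = ((-(π ^ 2 / b) * ‖w‖ ^ 2 : ℝ) : ℂ) by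
        push_cast; ring]
      exact Complex.ofReal_re _
  have hb' : 0 < π ^ 2 / b := by positivity
  have hI := GaussianFourier.integral_rexp_neg_mul_sq_norm (V := V) hb'
  have hint : Integrable fun v : V => Real.exp (-(π ^ 2 / b) * ‖v‖ ^ 2) := by
    refine Integrable.of_integral_ne_zero ?_
    rw [hI]; positivity
  simp_rw [← ofReal_norm, e]
  rw [← ofReal_integral_eq_lintegral_ofReal (hint.const_mul _)
    (Filter.Eventually.of_forall fun v => by positivity), integral_const_mul, hI,
    ← Real.mul_rpow (by positivity) (by positivity)]
  have : π / b * (π / (π ^ 2 / b)) = 1 := by field_simp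
  rw [this]; simp

theorem lintegral_enorm_fourier_sq_mul_gaussian_le {G : V → ℂ} (hG : Integrable G) {b : ℝ}
    (hb : 0 < b) :
    ∫⁻ w, ‖𝓕 G w‖ₑ ^ 2 * ENNReal.ofReal (Real.exp (-b * ‖w‖ ^ 2)) ≤ ∫⁻ v, ‖G v‖ₑ ^ 2 := by
  set γ : V → ℂ := fun v => Complex.exp (-b * ‖v‖ ^ 2) with hγ
  have hγi : Integrable γ := by
    simpa [hγ] using GaussianFourier.integrable_cexp_neg_mul_sq_norm_add (V := V) (b := b)
      (by simpa using hb) 0 0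
  have hγr : ∀ w, γ w = ((Real.exp (-b * ‖w‖ ^ 2) : ℝ) : ℂ) := fun w => by simp [hγ]
  set H : V → V × V → ℂ := fun w p =>
    Complex.exp ((-2 * π * inner ℝ (p.1 - p.2) w : ℝ) * Complex.I) *
      (γ w * (G p.1 * conj (G p.2))) with hH
  have hGc : Integrable fun v => conj (G v) :=
    (LinearIsometryEquiv.integrable_comp_iff Complex.conjLIE).2 hG
  have hGG : Integrable (fun p : V × V => G p.1 * conj (G p.2)) := hG.mul_prod hGc
  have hHi : Integrable (Function.uncurry H) := by
    have h0 : Integrable (fun q : V × (V × V) => γ q.1 * (G q.2.1 * conj (G q.2.2))) :=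
      hγi.mul_prod hGG
    refine h0.bdd_mul (c := 1) ?_ (Filter.Eventually.of_forall fun q => ?_)
    · exact Continuous.aestronglyMeasurable (by fun_prop)
    · rw [Complex.norm_exp_ofReal_mul_I]
  have hsq : ∀ w, ∫ p, H w p = γ w * (𝓕 G w * conj (𝓕 G w)) := by
    intro w
    have hc : conj (𝓕 G w) = ∫ v, conj (Complex.exp (↑(-2 * π * inner ℝ v w) * Complex.I) * G v) := by
      rw [integral_conj, Real.fourier_eq']
      rfl
    rw [hc, Real.fourier_eq', ← integral_prod_mul, ← integral_const_mul]
    refine integral_congr_ae (Filter.Eventually.of_forall fun p => ?_)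
    simp only [hH, map_mul, smul_eq_mul, ← Complex.exp_conj, Complex.conj_ofReal, Complex.conj_I]
    rw [inner_sub_left, mul_sub, Complex.ofReal_sub, sub_mul, sub_eq_add_neg, Complex.exp_add,
      mul_neg]
    ring
  have hswap : ∀ p, ∫ w, H w p = G p.1 * conj (G p.2) * 𝓕 γ (p.1 - p.2) := by
    intro p
    rw [Real.fourier_eq', ← integral_const_mul]
    refine integral_congr_ae (Filter.Eventually.of_forall fun w => ?_)
    simp only [hH, smul_eq_mul, real_inner_comm w]
    ring
  have hpos : ∀ w, γ w * (𝓕 G w * conj (𝓕 G w)) =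
      ((‖𝓕 G w‖ ^ 2 * Real.exp (-b * ‖w‖ ^ 2) : ℝ) : ℂ) := by
    intro w
    rw [hγr, Complex.mul_conj, Complex.normSq_eq_norm_sq]
    push_cast; ring
  have hi : Integrable fun w => ‖𝓕 G w‖ ^ 2 * Real.exp (-b * ‖w‖ ^ 2) := by
    have := hHi.integral_prod_left
    simp only [Function.uncurry, hsq, hpos] at this
    exact this.re
  have e1 : ∫⁻ w, ‖𝓕 G w‖ₑ ^ 2 * ENNReal.ofReal (Real.exp (-b * ‖w‖ ^ 2)) =
      ‖∫ p : V × V, G p.1 * conj (G p.2) * 𝓕 γ (p.1 - p.2)‖ₑ := by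
    simp_rw [← hswap]
    rw [← integral_integral_swap hHi]
    simp_rw [hsq, hpos]
    rw [integral_complex_ofReal, ← ofReal_norm, Complex.norm_real, Real.norm_of_nonneg
      (integral_nonneg fun w => by positivity), ofReal_integral_eq_lintegral_ofReal hi
      (Filter.Eventually.of_forall fun w => by positivity)]
    refine lintegral_congr fun w => ?_
    rw [ENNReal.ofReal_mul (by positivity), ENNReal.ofReal_pow (by positivity),
      ofReal_norm]
  have hK : Measurable fun v => ‖𝓕 γ v‖ₑ := (continuous_fourier hγi).measurable.enorm
  set k : V → ℝ≥0∞ := fun v => ‖𝓕 γ v‖ₑ with hk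
  have hk1 : ∫⁻ v, k v = 1 := lintegral_enorm_fourier_gaussian hb
  have hGm : AEMeasurable fun v => ‖G v‖ₑ ^ 2 := hG.aestronglyMeasurable.enorm.pow_const 2
  have a1 : AEMeasurable (fun p : V × V => ‖G p.1‖ₑ ^ 2 * k (p.1 - p.2)) :=
    (hGm.comp_quasiMeasurePreserving Measure.quasiMeasurePreserving_fst).mul
      (hK.comp (by fun_prop)).aemeasurable
  have a2 : AEMeasurable (fun p : V × V => ‖G p.2‖ₑ ^ 2 * k (p.1 - p.2)) :=
    (hGm.comp_quasiMeasurePreserving Measure.quasiMeasurePreserving_snd).mul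
      (hK.comp (by fun_prop)).aemeasurable
  have s1 : ∫⁻ p : V × V, ‖G p.1‖ₑ ^ 2 * k (p.1 - p.2) = ∫⁻ v, ‖G v‖ₑ ^ 2 := by
    rw [Measure.volume_eq_prod, lintegral_prod _ a1]
    refine lintegral_congr fun v => ?_
    dsimp only
    rw [lintegral_const_mul' _ _ (by simp), lintegral_sub_left_eq_self k v, hk1, mul_one]
  have s2 : ∫⁻ p : V × V, ‖G p.2‖ₑ ^ 2 * k (p.1 - p.2) = ∫⁻ v, ‖G v‖ₑ ^ 2 := by
    rw [Measure.volume_eq_prod, lintegral_prod_symm _ a2]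
    refine lintegral_congr fun v => ?_
    dsimp only
    rw [lintegral_const_mul' _ _ (by simp), lintegral_sub_right_eq_self k v, hk1,
      mul_one]
  rw [e1]
  refine (enorm_integral_le_lintegral_enorm _).trans ?_
  have hle : ∀ p : V × V, ‖G p.1 * conj (G p.2) * 𝓕 γ (p.1 - p.2)‖ₑ ≤
      2⁻¹ * (‖G p.1‖ₑ ^ 2 * k (p.1 - p.2) + ‖G p.2‖ₑ ^ 2 * k (p.1 - p.2)) := by
    intro p
    rw [enorm_mul, enorm_mul, RCLike.enorm_conj, ← add_mul, ← mul_assoc]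
    refine mul_le_mul_left ?_ _
    simp only [enorm_eq_nnnorm]
    rw [← ENNReal.coe_ofNat, ← ENNReal.coe_inv two_ne_zero]
    norm_cast
    rw [← NNReal.coe_le_coe]
    push_cast
    nlinarith [sq_nonneg (‖G p.1‖ - ‖G p.2‖)]
  refine (lintegral_mono hle).trans ?_
  rw [lintegral_const_mul' _ _ (by simp), lintegral_add_left' a1, s1, s2, ← two_mul, ← mul_assoc,
    ENNReal.inv_mul_cancel (by simp) (by simp), one_mul]

theorem lintegral_enorm_fourier_sq_le {G : V → ℂ} (hG : Integrable G) :
    ∫⁻ w, ‖𝓕 G w‖ₑ ^ 2 ≤ ∫⁻ v, ‖G v‖ₑ ^ 2 := by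
  have hc := continuous_fourier hG
  set f : ℕ → V → ℝ≥0∞ := fun n w =>
    ‖𝓕 G w‖ₑ ^ 2 * ENNReal.ofReal (Real.exp (-(1 / ((n : ℝ) + 1)) * ‖w‖ ^ 2)) with hf
  have hlim : ∀ w, Filter.Tendsto (fun n => f n w) Filter.atTop (nhds (‖𝓕 G w‖ₑ ^ 2)) := by
    intro w
    have h1 : Filter.Tendsto (fun n : ℕ => Real.exp (-(1 / ((n : ℝ) + 1)) * ‖w‖ ^ 2))
        Filter.atTop (nhds 1) := by
      have := ((tendsto_one_div_add_atTop_nhds_zero_nat (𝕜 := ℝ)).neg.mul_const (‖w‖ ^ 2)).rexp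
      simpa using this
    have h2 := ENNReal.Tendsto.const_mul (a := ‖𝓕 G w‖ₑ ^ 2) (ENNReal.tendsto_ofReal h1)
      (Or.inl (by simp))
    simpa [hf] using h2
  calc ∫⁻ w, ‖𝓕 G w‖ₑ ^ 2 = ∫⁻ w, Filter.liminf (fun n => f n w) Filter.atTop :=
        lintegral_congr fun w => (hlim w).liminf_eq.symm
    _ ≤ Filter.liminf (fun n => ∫⁻ w, f n w) Filter.atTop :=
        lintegral_liminf_le fun n => by fun_prop
    _ ≤ ∫⁻ v, ‖G v‖ₑ ^ 2 := by
        refine Filter.liminf_le_of_le (by isBoundedDefault) fun c hc => ?_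
        obtain ⟨n, hn⟩ := hc.exists
        exact hn.trans (lintegral_enorm_fourier_sq_mul_gaussian_le hG (by positivity))

theorem lintegral_convolution_sq_le {h : V → ℝ≥0∞} (hh : Measurable h) :
    ∫⁻ x, (∫⁻ y, h y ^ (3 / 4 : ℝ) * h (x - y) ^ (3 / 4 : ℝ)) ^ 2 ≤ (∫⁻ x, h x) ^ 3 := by
  have hsub : ∀ x : V, Measurable fun y => h (x - y) := fun x => hh.comp (by fun_prop)
  have hpt : ∀ x, (∫⁻ y, h y ^ (3 / 4 : ℝ) * h (x - y) ^ (3 / 4 : ℝ)) ^ 2 ≤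
      (∫⁻ y, h y * h (x - y)) * ∫⁻ y, h y := by
    intro x
    have hx := hsub x
    have c22 : Real.HolderConjugate 2 2 := Real.HolderConjugate.two_two
    have h1 : ∫⁻ y, h y ^ (3 / 4 : ℝ) * h (x - y) ^ (3 / 4 : ℝ) ≤
        (∫⁻ y, h y * h (x - y)) ^ (1 / 2 : ℝ) *
          (∫⁻ y, h y ^ (1 / 2 : ℝ) * h (x - y) ^ (1 / 2 : ℝ)) ^ (1 / 2 : ℝ) := by
      have := ENNReal.lintegral_mul_le_Lp_mul_Lq volume c22
        (f := fun y => (h y * h (x - y)) ^ (1 / 2 : ℝ))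
        (g := fun y => (h y * h (x - y)) ^ (1 / 4 : ℝ)) (by fun_prop) (by fun_prop)
      simp only [Pi.mul_apply, ← ENNReal.rpow_mul] at this
      norm_num at this
      refine le_of_eq_of_le (lintegral_congr fun y => ?_) (this.trans (le_of_eq ?_))
      · rw [← ENNReal.mul_rpow_of_nonneg _ _ (by norm_num),
          ← ENNReal.rpow_add_of_nonneg _ _ (by norm_num) (by norm_num)]
        norm_num
      · norm_num
        congr 2
        refine lintegral_congr fun y => ?_
        rw [ENNReal.mul_rpow_of_nonneg _ _ (by norm_num)]
    have h2 : ∫⁻ y, h y ^ (1 / 2 : ℝ) * h (x - y) ^ (1 / 2 : ℝ) ≤ ∫⁻ y, h y := by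
      have := ENNReal.lintegral_mul_le_Lp_mul_Lq volume c22
        (f := fun y => h y ^ (1 / 2 : ℝ)) (g := fun y => h (x - y) ^ (1 / 2 : ℝ))
        (by fun_prop) (by fun_prop)
      simp only [Pi.mul_apply, ← ENNReal.rpow_mul] at this
      norm_num at this
      rw [lintegral_sub_left_eq_self h x,
        ← ENNReal.rpow_add_of_nonneg _ _ (by norm_num) (by norm_num)] at this
      norm_num at this
      simpa using this
    calc _ ≤ ((∫⁻ y, h y * h (x - y)) ^ (1 / 2 : ℝ) * (∫⁻ y, h y) ^ (1 / 2 : ℝ)) ^ 2 := by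
          gcongr
          exact h1.trans (by gcongr)
      _ = _ := by
          rw [← ENNReal.mul_rpow_of_nonneg _ _ (by norm_num), ← ENNReal.rpow_natCast,
            ← ENNReal.rpow_mul]
          norm_num
  have hm : Measurable fun p : V × V => h p.2 * h (p.1 - p.2) :=
    (hh.comp measurable_snd).mul (hh.comp (by fun_prop))
  calc _ ≤ ∫⁻ x, (∫⁻ y, h y * h (x - y)) * ∫⁻ y, h y := lintegral_mono hpt
    _ = (∫⁻ x, ∫⁻ y, h y * h (x - y)) * ∫⁻ y, h y :=
        lintegral_mul_const _ hm.lintegral_prod_right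
    _ = _ := by
        rw [lintegral_lintegral_swap hm.aemeasurable]
        have : ∀ y, ∫⁻ x, h y * h (x - y) = h y * ∫⁻ x, h x := fun y => by
          have : Measurable fun x => h (x - y) := hh.comp (by fun_prop)
          rw [lintegral_const_mul _ this, lintegral_sub_right_eq_self h y]
        simp_rw [this]
        rw [lintegral_mul_const _ hh]
        ring

/-- The Hausdorff–Young inequality `L^(4/3) → L^4` for integrable functions. -/
theorem hausdorffYoung {F : V → ℂ} (hF : Integrable F) :
    ∫⁻ w, ‖𝓕 F w‖ₑ ^ 4 ≤ (∫⁻ v, ‖F v‖ₑ ^ (4 / 3 : ℝ)) ^ 3 := by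
  wlog hm : StronglyMeasurable F generalizing F
  · have hae := hF.aestronglyMeasurable.ae_eq_mk
    have := this (hF.congr hae) hF.aestronglyMeasurable.stronglyMeasurable_mk
    have e : 𝓕 F = 𝓕 (hF.aestronglyMeasurable.mk F) := by
      ext w
      rw [Real.fourier_eq, Real.fourier_eq]
      refine integral_congr_ae ?_
      filter_upwards [hae] with v hv
      rw [hv]
    rw [e]
    refine this.trans (le_of_eq ?_)
    congr 1
    refine lintegral_congr_ae ?_
    filter_upwards [hae] with v hv
    rw [hv]
  have hconv : ∀ w, 𝓕 (convolution F F (ContinuousLinearMap.mul ℂ ℂ) volume) w = 𝓕 F w * 𝓕 F w :=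
    Real.fourier_mul_convolution_eq hF hF
  have hci : Integrable (convolution F F (ContinuousLinearMap.mul ℂ ℂ) volume) :=
    hF.integrable_convolution _ hF
  have hmeas : Measurable fun v => ‖F v‖ₑ := hm.measurable.enorm
  calc ∫⁻ w, ‖𝓕 F w‖ₑ ^ 4 =
        ∫⁻ w, ‖𝓕 (convolution F F (ContinuousLinearMap.mul ℂ ℂ) volume) w‖ₑ ^ 2 :=
        lintegral_congr fun w => by rw [hconv, enorm_mul]; ring
    _ ≤ ∫⁻ x, ‖convolution F F (ContinuousLinearMap.mul ℂ ℂ) volume x‖ₑ ^ 2 :=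
        lintegral_enorm_fourier_sq_le hci
    _ ≤ ∫⁻ x, (∫⁻ y, (‖F y‖ₑ ^ (4 / 3 : ℝ)) ^ (3 / 4 : ℝ) *
          (‖F (x - y)‖ₑ ^ (4 / 3 : ℝ)) ^ (3 / 4 : ℝ)) ^ 2 := by
        gcongr with x
        refine (enorm_integral_le_lintegral_enorm _).trans (le_of_eq ?_)
        refine lintegral_congr fun y => ?_
        rw [← ENNReal.rpow_mul, ← ENNReal.rpow_mul]
        norm_num
    _ ≤ _ := lintegral_convolution_sq_le (h := fun v => ‖F v‖ₑ ^ (4 / 3 : ℝ)) (by fun_prop)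

end HausdorffYoung

section Extension

open scoped FourierTransform

/-- The Hausdorff–Young inequality on `ℝ × ℝ`, for the Fourier transform normalised without `2π`. -/
theorem hausdorffYoung_prod {F : ℝ × ℝ → ℂ} (hF : Integrable F) :
    ∫⁻ z : ℝ × ℝ, ‖∫ p : ℝ × ℝ, Complex.exp (Complex.I * (p.1 * z.1 + p.2 * z.2)) * F p‖ₑ ^ 4 ≤
      ENNReal.ofReal (4 * π ^ 2) * (∫⁻ p, ‖F p‖ₑ ^ (4 / 3 : ℝ)) ^ 3 := by
  set e := Complex.measurableEquivRealProd
  have he : MeasurePreserving e volume volume := Complex.volume_preserving_equiv_real_prod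
  set U : ℝ × ℝ → ℂ :=
    fun z => ∫ p : ℝ × ℝ, Complex.exp (Complex.I * (p.1 * z.1 + p.2 * z.2)) * F p with hU
  have hFe : Integrable (F ∘ e) := (he.integrable_comp_emb e.measurableEmbedding).2 hF
  have hfour : ∀ w : ℂ, 𝓕 (F ∘ e) w = U ((-(2 * π)) • e w) := by
    intro w
    rw [Real.fourier_eq', hU]
    dsimp only
    rw [← he.integral_comp e.measurableEmbedding]
    refine integral_congr_ae (Filter.Eventually.of_forall fun v => ?_)
    simp only [e, Complex.measurableEquivRealProd_apply, Complex.inner, smul_eq_mul,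
      Function.comp_apply, Prod.smul_mk]
    congr 2
    simp
    ring
  have hUm : Continuous U := by
    have h : U = fun z => 𝓕 (F ∘ e) (e.symm ((-(2 * π))⁻¹ • z)) := by
      ext z
      rw [hfour, MeasurableEquiv.apply_symm_apply, smul_inv_smul₀ (by simp [pi_ne_zero])]
    have hes : Continuous e.symm := Complex.equivRealProdCLM.symm.continuous
    rw [h]
    exact (continuous_fourier hFe).comp (hes.comp (by fun_prop))
  have hscale : ∫⁻ z, ‖U z‖ₑ ^ 4 =
      ENNReal.ofReal (4 * π ^ 2) * ∫⁻ z, ‖U ((-(2 * π)) • z)‖ₑ ^ 4 := by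
    have hne : (-(2 * π)) ≠ 0 := by simp [pi_ne_zero]
    have hm := Measure.map_addHaar_smul (volume : Measure (ℝ × ℝ)) hne
    have hl := lintegral_map (μ := volume) (f := fun z => ‖U z‖ₑ ^ 4)
      (g := fun z : ℝ × ℝ => (-(2 * π)) • z) (by fun_prop) (by fun_prop)
    rw [← hl, hm, lintegral_smul_measure, smul_eq_mul, ← mul_assoc,
      ← ENNReal.ofReal_mul (by positivity)]
    have : 4 * π ^ 2 * |((-(2 * π)) ^ Module.finrank ℝ (ℝ × ℝ))⁻¹| = 1 := by
      rw [show Module.finrank ℝ (ℝ × ℝ) = 2 by simp, abs_of_pos (by positivity)]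
      field_simp; ring
    rw [this]; simp
  rw [hscale]
  gcongr
  rw [← he.lintegral_comp_emb e.measurableEmbedding, ← he.lintegral_comp_emb e.measurableEmbedding]
  simp_rw [← hfour]
  exact hausdorffYoung hFe

/-- The map `(ξ, η) ↦ (ξ + η, ψ ξ + ψ η)` for the cubic `ψ ξ = μ ξ³ + κ ξ²`. -/
def cubicSum (μ κ : ℝ) (p : ℝ × ℝ) : ℝ × ℝ :=
  (p.1 + p.2, (μ * p.1 ^ 3 + κ * p.1 ^ 2) + (μ * p.2 ^ 3 + κ * p.2 ^ 2))

/-- The derivative of `cubicSum`. -/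
def fderivCubicSum (μ κ : ℝ) (p : ℝ × ℝ) : ℝ × ℝ →L[ℝ] ℝ × ℝ :=
  (Matrix.toLin (.finTwoProd ℝ) (.finTwoProd ℝ)
    !![1, 1; 3 * μ * p.1 ^ 2 + 2 * κ * p.1, 3 * μ * p.2 ^ 2 + 2 * κ * p.2]).toContinuousLinearMap

theorem hasFDerivAt_cubicSum (μ κ : ℝ) (p : ℝ × ℝ) :
    HasFDerivAt (cubicSum μ κ) (fderivCubicSum μ κ p) p := by
  unfold fderivCubicSum
  rw [Matrix.toLin_finTwoProd_toContinuousLinearMap]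
  have hd : ∀ x : ℝ, HasDerivAt (fun x => μ * x ^ 3 + κ * x ^ 2) (3 * μ * x ^ 2 + 2 * κ * x) x := by
    intro x
    refine HasDerivAt.congr_deriv
      (((hasDerivAt_pow 3 x).const_mul μ).add ((hasDerivAt_pow 2 x).const_mul κ)) ?_
    norm_num
    ring
  have h1 := (hd p.1).comp_hasFDerivAt p (hasFDerivAt_fst (𝕜 := ℝ) (p := p))
  have h2 := (hd p.2).comp_hasFDerivAt p (hasFDerivAt_snd (𝕜 := ℝ) (p := p))
  have h := ((hasFDerivAt_fst (𝕜 := ℝ) (p := p)).add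
    (hasFDerivAt_snd (𝕜 := ℝ) (p := p))).prodMk (h1.add h2)
  refine h.congr_fderiv ?_
  ext <;> simp

theorem det_fderivCubicSum (μ κ : ℝ) (p : ℝ × ℝ) :
    (fderivCubicSum μ κ p).det = (p.2 - p.1) * (3 * μ * (p.1 + p.2) + 2 * κ) := by
  unfold fderivCubicSum
  simp only [LinearMap.det_toContinuousLinearMap, LinearMap.det_toLin, Matrix.det_fin_two_of]
  ring

/-- The pairs `(ξ, η)` in `S × S` with `ξ < η`. -/
def upperPairs (S : Set ℝ) : Set (ℝ × ℝ) := {p | p.1 ∈ S ∧ p.2 ∈ S ∧ p.1 < p.2}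

theorem measurableSet_upperPairs {S : Set ℝ} (hS : MeasurableSet S) :
    MeasurableSet (upperPairs S) :=
  (measurable_fst hS).inter ((measurable_snd hS).inter
    (measurableSet_lt measurable_fst measurable_snd))

theorem injOn_cubicSum {μ κ : ℝ} (hμ : μ ≠ 0) {S : Set ℝ}
    (hS : ∀ ξ ∈ S, ∀ η ∈ S, 3 * |μ| * |ξ - η| ≤ |3 * μ * (ξ + η) + 2 * κ|) :
    Set.InjOn (cubicSum μ κ) (upperPairs S) := by
  rintro ⟨a, b⟩ ⟨ha, hb, hab⟩ ⟨c, d⟩ ⟨-, -, hcd⟩ h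
  simp only [cubicSum, Prod.mk.injEq] at h hab hcd ha hb
  obtain ⟨h1, h2⟩ := h
  have hne : 3 * μ * (a + b) + 2 * κ ≠ 0 := by
    have h0 : 0 < 3 * |μ| * |a - b| :=
      mul_pos (by positivity) (abs_pos.2 (sub_ne_zero.2 hab.ne))
    exact abs_pos.1 (h0.trans_le (hS a ha b hb))
  have hc : c = a + b - d := by linarith
  subst hc
  have key : (3 * μ * (a + b) + 2 * κ) * ((b - a) ^ 2 - (d - (a + b - d)) ^ 2) = 0 := by
    linear_combination 4 * h2
  have hsq := (mul_eq_zero.1 key).resolve_left hne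
  have : (b - a - (d - (a + b - d))) * (b - a + (d - (a + b - d))) = 0 := by
    linear_combination hsq
  have h3 := (mul_eq_zero.1 this).resolve_right (by linarith)
  simp only [Prod.mk.injEq]
  constructor <;> linarith

theorem setIntegral_prod_self_eq_two_mul {S : Set ℝ} (hS : MeasurableSet S) {h : ℝ × ℝ → ℂ}
    (hi : Integrable h) (hsymm : ∀ p, h p.swap = h p) :
    ∫ p in S ×ˢ S, h p = 2 * ∫ p in upperPairs S, h p := by
  have hR := measurableSet_upperPairs hS
  have hdiag : volume {p : ℝ × ℝ | p.1 = p.2} = 0 := by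
    rw [Measure.volume_eq_prod, Measure.measure_prod_null
      (measurableSet_eq_fun measurable_fst measurable_snd)]
    refine Filter.Eventually.of_forall fun x => ?_
    have : Prod.mk x ⁻¹' {p : ℝ × ℝ | p.1 = p.2} = {x} := by
      ext y; simp [eq_comm]
    change volume (Prod.mk x ⁻¹' {p : ℝ × ℝ | p.1 = p.2}) = 0
    rw [this]; simp
  have hae : (S ×ˢ S : Set (ℝ × ℝ)) =ᵐ[volume]
      (upperPairs S ∪ Prod.swap ⁻¹' upperPairs S : Set (ℝ × ℝ)) := by
    have hd : ∀ᵐ p : ℝ × ℝ, p.1 ≠ p.2 := measure_eq_zero_iff_ae_notMem.1 hdiag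
    filter_upwards [hd] with p hp
    refine propext ⟨fun hm => ?_, ?_⟩
    · rcases lt_or_gt_of_ne hp with h | h
      · exact Or.inl ⟨hm.1, hm.2, h⟩
      · exact Or.inr ⟨hm.2, hm.1, h⟩
    · rintro (hm | hm)
      · exact ⟨hm.1, hm.2.1⟩
      · exact ⟨hm.2.1, hm.1⟩
  have hdisj : Disjoint (upperPairs S) (Prod.swap ⁻¹' upperPairs S) :=
    Set.disjoint_left.2 fun p hp hq => lt_asymm hp.2.2 hq.2.2
  rw [setIntegral_congr_set hae, setIntegral_union hdisj (measurable_swap hR) hi.integrableOn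
    hi.integrableOn]
  have hsw := (Measure.measurePreserving_swap (μ := (volume : Measure ℝ))
    (ν := (volume : Measure ℝ))).setIntegral_preimage_emb
    MeasurableEquiv.prodComm.measurableEmbedding h (upperPairs S)
  simp_rw [hsymm] at hsw
  rw [Measure.volume_eq_prod, hsw, two_mul]

/-- The bilinear form of `f` in the variables `cubicSum μ κ`, including the Jacobian. -/
def pushProd (μ κ : ℝ) (S : Set ℝ) (f : ℝ → ℂ) : ℝ × ℝ → ℂ :=
  (cubicSum μ κ '' upperPairs S).indicator fun q =>
    (fun p : ℝ × ℝ => f p.1 * f p.2 / (|(fderivCubicSum μ κ p).det| : ℝ))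
      (Function.invFunOn (cubicSum μ κ) (upperPairs S) q)

theorem pushProd_cubicSum {μ κ : ℝ} {S : Set ℝ} (hinj : Set.InjOn (cubicSum μ κ) (upperPairs S))
    (f : ℝ → ℂ) {p : ℝ × ℝ} (hp : p ∈ upperPairs S) :
    pushProd μ κ S f (cubicSum μ κ p) =
      f p.1 * f p.2 / (|(fderivCubicSum μ κ p).det| : ℝ) := by
  rw [pushProd, Set.indicator_of_mem (Set.mem_image_of_mem _ hp), hinj.leftInvOn_invFunOn hp]

theorem abs_det_fderivCubicSum_ge {μ κ : ℝ} {S : Set ℝ}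
    (hS : ∀ ξ ∈ S, ∀ η ∈ S, 3 * |μ| * |ξ - η| ≤ |3 * μ * (ξ + η) + 2 * κ|)
    {p : ℝ × ℝ} (hp : p ∈ upperPairs S) :
    3 * |μ| * |p.1 - p.2| ^ 2 ≤ |(fderivCubicSum μ κ p).det| := by
  rw [det_fderivCubicSum, abs_mul, abs_sub_comm p.2 p.1]
  have := mul_le_mul_of_nonneg_left (hS _ hp.1 _ hp.2.1) (abs_nonneg (p.1 - p.2))
  linarith

theorem lintegral_pushProd_le {μ κ : ℝ} (hμ : μ ≠ 0) {S : Set ℝ} (hSm : MeasurableSet S)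
    (hS : ∀ ξ ∈ S, ∀ η ∈ S, 3 * |μ| * |ξ - η| ≤ |3 * μ * (ξ + η) + 2 * κ|)
    {f : ℝ → ℂ} (hfm : Measurable f) :
    ∫⁻ q, ‖pushProd μ κ S f q‖ₑ ^ (4 / 3 : ℝ) ≤
      ENNReal.ofReal ((3 * |μ|) ^ (-(1 / 3) : ℝ)) *
        (16 * (∫⁻ x, ‖f x‖ₑ ^ 2) ^ (4 / 3 : ℝ)) := by
  have hR := measurableSet_upperPairs hSm
  have hinj := injOn_cubicSum hμ hS
  have hder : ∀ p ∈ upperPairs S,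
      HasFDerivWithinAt (cubicSum μ κ) (fderivCubicSum μ κ p) (upperPairs S) p :=
    fun p _ => (hasFDerivAt_cubicSum μ κ p).hasFDerivWithinAt
  have him := measurable_image_of_fderivWithin hR hder hinj
  set g : ℝ → ℝ≥0∞ := fun x => ‖f x‖ₑ ^ (4 / 3 : ℝ) with hg
  have hgm : Measurable g := by fun_prop
  have e1 : ∫⁻ q, ‖pushProd μ κ S f q‖ₑ ^ (4 / 3 : ℝ) =
      ∫⁻ q in cubicSum μ κ '' upperPairs S, ‖pushProd μ κ S f q‖ₑ ^ (4 / 3 : ℝ) := by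
    rw [← lintegral_indicator him]
    refine lintegral_congr fun q => ?_
    by_cases hq : q ∈ cubicSum μ κ '' upperPairs S
    · rw [Set.indicator_of_mem hq]
    · rw [Set.indicator_of_notMem hq, pushProd, Set.indicator_of_notMem hq]
      simp
  rw [e1, lintegral_image_eq_lintegral_abs_det_fderiv_mul volume hR hder hinj]
  calc _ ≤ ∫⁻ p in upperPairs S, ENNReal.ofReal ((3 * |μ|) ^ (-(1 / 3) : ℝ)) *
        (g p.2 * g p.1 * rieszKernel (p.2 - p.1)) := by
        refine setLIntegral_mono' hR fun p hp => ?_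
        rw [pushProd_cubicSum hinj f hp]
        have hd := abs_det_fderivCubicSum_ge hS hp
        have hsub : 0 < |p.1 - p.2| := abs_pos.2 (sub_ne_zero.2 hp.2.2.ne)
        have hμ' : 0 < 3 * |μ| := by positivity
        set j := |(fderivCubicSum μ κ p).det|
        have hj : 0 < j := lt_of_lt_of_le (by positivity) hd
        have ej : ‖f p.1 * f p.2 / (j : ℂ)‖ₑ ^ (4 / 3 : ℝ) =
            g p.2 * g p.1 * ENNReal.ofReal (j ^ (-(4 / 3) : ℝ)) := by
          rw [div_eq_mul_inv, enorm_mul, enorm_mul, ENNReal.mul_rpow_of_nonneg _ _ (by norm_num),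
            ENNReal.mul_rpow_of_nonneg _ _ (by norm_num), mul_comm (g p.2)]
          congr 1
          rw [← Complex.ofReal_inv, ← ofReal_norm, Complex.norm_real, Real.norm_of_nonneg
            (by positivity), ENNReal.ofReal_rpow_of_pos (by positivity), Real.inv_rpow hj.le,
            Real.rpow_neg hj.le]
        have hjj : j * j ^ (-(4 / 3) : ℝ) ≤
            (3 * |μ|) ^ (-(1 / 3) : ℝ) * |p.2 - p.1| ^ (-(2 / 3) : ℝ) := by
          calc j * j ^ (-(4 / 3) : ℝ) = j ^ (-(1 / 3) : ℝ) := by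
                nth_rewrite 1 [← Real.rpow_one j]
                rw [← Real.rpow_add hj]; norm_num
            _ ≤ (3 * |μ| * |p.1 - p.2| ^ 2) ^ (-(1 / 3) : ℝ) :=
                Real.rpow_le_rpow_of_nonpos (by positivity) hd (by norm_num)
            _ = _ := by
                rw [Real.mul_rpow hμ'.le (by positivity), ← Real.rpow_natCast,
                  ← Real.rpow_mul hsub.le, abs_sub_comm]
                norm_num
        rw [ej, rieszKernel]
        calc _ = ENNReal.ofReal (j * j ^ (-(4 / 3) : ℝ)) * (g p.2 * g p.1) := by
              rw [ENNReal.ofReal_mul hj.le]; ring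
          _ ≤ ENNReal.ofReal ((3 * |μ|) ^ (-(1 / 3) : ℝ) * |p.2 - p.1| ^ (-(2 / 3) : ℝ)) *
              (g p.2 * g p.1) := by gcongr
          _ = _ := by rw [ENNReal.ofReal_mul (by positivity)]; ring
    _ ≤ ∫⁻ p : ℝ × ℝ, ENNReal.ofReal ((3 * |μ|) ^ (-(1 / 3) : ℝ)) *
        (g p.2 * g p.1 * rieszKernel (p.2 - p.1)) := setLIntegral_le_lintegral _ _
    _ = ENNReal.ofReal ((3 * |μ|) ^ (-(1 / 3) : ℝ)) *
        ∫⁻ y, ∫⁻ x, g x * g y * rieszKernel (x - y) := by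
        have hm : Measurable fun p : ℝ × ℝ => g p.2 * g p.1 * rieszKernel (p.2 - p.1) := by
          fun_prop
        rw [lintegral_const_mul _ hm, Measure.volume_eq_prod, lintegral_prod _ hm.aemeasurable]
    _ ≤ _ := by
        gcongr
        refine (hardyLittlewoodSobolev g hgm).trans (le_of_eq ?_)
        congr 3
        ext x
        rw [hg, ← ENNReal.rpow_mul, ← ENNReal.rpow_natCast]
        norm_num

/-- The oscillatory extension operator of the curve `τ = μ ξ³ + κ ξ²` over the set `S`. -/
def cubicExtension (μ κ : ℝ) (S : Set ℝ) (f : ℝ → ℂ) (z : ℝ × ℝ) : ℂ :=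
  ∫ ξ in S, Complex.exp (Complex.I * (ξ * z.1 + ((μ * ξ ^ 3 + κ * ξ ^ 2 : ℝ) : ℂ) * z.2)) * f ξ

theorem lintegral_cubicExtension_le {μ : ℝ} (hμ : μ ≠ 0) :
    ∃ K : ℝ≥0, ∀ (κ : ℝ) (S : Set ℝ), MeasurableSet S →
      (∀ ξ ∈ S, ∀ η ∈ S, 3 * |μ| * |ξ - η| ≤ |3 * μ * (ξ + η) + 2 * κ|) →
      ∀ f : ℝ → ℂ, Measurable f → Integrable f →
        ∫⁻ z, ‖cubicExtension μ κ S f z‖ₑ ^ 8 ≤ K * (∫⁻ x, ‖f x‖ₑ ^ 2) ^ 4 := by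
  refine ⟨16 * (4 * π ^ 2).toNNReal * (((3 * |μ|) ^ (-(1 / 3) : ℝ)).toNNReal * 16) ^ 3,
    fun κ S hSm hS f hfm hf => ?_⟩
  have hR := measurableSet_upperPairs hSm
  have hinj := injOn_cubicSum hμ hS
  have hder : ∀ p ∈ upperPairs S,
      HasFDerivWithinAt (cubicSum μ κ) (fderivCubicSum μ κ p) (upperPairs S) p :=
    fun p _ => (hasFDerivAt_cubicSum μ κ p).hasFDerivWithinAt
  have him := measurable_image_of_fderivWithin hR hder hinj
  have hff : Integrable fun p : ℝ × ℝ => f p.1 * f p.2 := hf.mul_prod hf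
  have hjac : ∀ p ∈ upperPairs S, |(fderivCubicSum μ κ p).det| • pushProd μ κ S f (cubicSum μ κ p) =
      f p.1 * f p.2 := by
    intro p hp
    have hsub : 0 < |p.1 - p.2| := abs_pos.2 (sub_ne_zero.2 hp.2.2.ne)
    have hj : 0 < |(fderivCubicSum μ κ p).det| :=
      lt_of_lt_of_le (by positivity) (abs_det_fderivCubicSum_ge hS hp)
    rw [pushProd_cubicSum hinj f hp, Complex.real_smul]
    have : ((|(fderivCubicSum μ κ p).det| : ℝ) : ℂ) ≠ 0 := by exact_mod_cast hj.ne'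
    field_simp
  have hsupp : ∀ q ∉ cubicSum μ κ '' upperPairs S, pushProd μ κ S f q = 0 := fun q hq =>
    Set.indicator_of_notMem hq _
  have hFi : Integrable (pushProd μ κ S f) := by
    rw [← integrableOn_iff_integrable_of_support_subset
      (fun q hq => by_contra fun h => hq (hsupp q h)),
      integrableOn_image_iff_integrableOn_abs_det_fderiv_smul volume hR hder hinj]
    exact hff.integrableOn.congr_fun (fun p hp => (hjac p hp).symm) hR
  have hsq : ∀ z : ℝ × ℝ, cubicExtension μ κ S f z ^ 2 =
      2 * ∫ q : ℝ × ℝ, Complex.exp (Complex.I * (q.1 * z.1 + q.2 * z.2)) * pushProd μ κ S f q := by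
    intro z
    set E : ℝ → ℂ := fun ξ =>
      Complex.exp (Complex.I * (ξ * z.1 + ((μ * ξ ^ 3 + κ * ξ ^ 2 : ℝ) : ℂ) * z.2)) with hE
    have hEf : Integrable fun ξ => E ξ * f ξ := by
      refine hf.bdd_mul (c := 1) (Continuous.aestronglyMeasurable (by fun_prop))
        (Filter.Eventually.of_forall fun ξ => ?_)
      rw [hE]
      dsimp only
      rw [mul_comm Complex.I]
      exact_mod_cast (Complex.norm_exp_ofReal_mul_I _).le
    have h1 : cubicExtension μ κ S f z ^ 2 =
        ∫ p in S ×ˢ S, (E p.1 * f p.1) * (E p.2 * f p.2) := by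
      rw [Measure.volume_eq_prod,
        setIntegral_prod_mul (fun ξ => E ξ * f ξ) (fun ξ => E ξ * f ξ), sq]
      rfl
    rw [h1, setIntegral_prod_self_eq_two_mul hSm (hEf.mul_prod hEf)
      (fun p => mul_comm _ _)]
    congr 1
    have h2 := setIntegral_eq_integral_of_forall_compl_eq_zero (μ := volume)
      (s := cubicSum μ κ '' upperPairs S) (f := fun q : ℝ × ℝ =>
        Complex.exp (Complex.I * (q.1 * z.1 + q.2 * z.2)) * pushProd μ κ S f q)
      (fun q hq => by rw [hsupp q hq, mul_zero])
    rw [← h2, integral_image_eq_integral_abs_det_fderiv_smul volume hR hder hinj]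
    refine setIntegral_congr_fun hR fun p hp => ?_
    rw [← mul_smul_comm, hjac p hp, hE]
    dsimp only [cubicSum]
    rw [mul_mul_mul_comm, ← Complex.exp_add]
    congr 2
    push_cast
    ring
  calc ∫⁻ z, ‖cubicExtension μ κ S f z‖ₑ ^ 8 =
        ∫⁻ z : ℝ × ℝ, 16 * ‖∫ q : ℝ × ℝ,
          Complex.exp (Complex.I * (q.1 * z.1 + q.2 * z.2)) * pushProd μ κ S f q‖ₑ ^ 4 := by
        refine lintegral_congr fun z => ?_
        rw [show 8 = 2 * 4 by norm_num, pow_mul, ← enorm_pow, hsq, enorm_mul, mul_pow]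
        congr 1
        rw [← ofReal_norm]
        norm_num
    _ = 16 * ∫⁻ z : ℝ × ℝ, ‖∫ q : ℝ × ℝ,
          Complex.exp (Complex.I * (q.1 * z.1 + q.2 * z.2)) * pushProd μ κ S f q‖ₑ ^ 4 :=
        lintegral_const_mul' _ _ (by simp)
    _ ≤ 16 * (ENNReal.ofReal (4 * π ^ 2) * (ENNReal.ofReal ((3 * |μ|) ^ (-(1 / 3) : ℝ)) *
        (16 * (∫⁻ x, ‖f x‖ₑ ^ 2) ^ (4 / 3 : ℝ))) ^ 3) := by
        gcongr
        refine (hausdorffYoung_prod hFi).trans ?_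
        gcongr
        exact lintegral_pushProd_le hμ hSm hS hfm
    _ = _ := by
        rw [mul_pow, mul_pow, ← ENNReal.rpow_natCast (_ ^ (4 / 3 : ℝ)), ← ENNReal.rpow_mul]
        rw [show (4 / 3 : ℝ) * (3 : ℕ) = (4 : ℕ) by norm_num, ENNReal.rpow_natCast]
        push_cast [ENNReal.ofReal]
        ring

end Extension

section Splitting

open scoped FourierTransform

theorem three_mul_abs_mul_abs_sub_le {μ κ c : ℝ} (hc : 3 * μ * c + κ = 0) {S : Set ℝ}
    (hS : S ⊆ Set.Ici c ∨ S ⊆ Set.Iic c) :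
    ∀ ξ ∈ S, ∀ η ∈ S, 3 * |μ| * |ξ - η| ≤ |3 * μ * (ξ + η) + 2 * κ| := by
  intro ξ hξ η hη
  have e : 3 * μ * (ξ + η) + 2 * κ = 3 * μ * ((ξ - c) + (η - c)) := by linear_combination 2 * hc
  rw [e, abs_mul, abs_mul, abs_of_pos (by norm_num : (0 : ℝ) < 3)]
  gcongr 3 * |μ| * ?_
  rcases hS with hS | hS
  · have h1 : c ≤ ξ := hS hξ
    have h2 : c ≤ η := hS hη
    rw [abs_of_nonneg (by linarith : 0 ≤ ξ - c + (η - c)), abs_le]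
    constructor <;> linarith
  · have h1 : ξ ≤ c := hS hξ
    have h2 : η ≤ c := hS hη
    rw [abs_of_nonpos (by linarith : ξ - c + (η - c) ≤ 0), abs_le]
    constructor <;> linarith

theorem aestronglyMeasurable_cubicExtension (μ κ : ℝ) (S : Set ℝ) {f : ℝ → ℂ}
    (hf : Measurable f) : AEStronglyMeasurable (cubicExtension μ κ S f) :=
  (StronglyMeasurable.integral_prod_right (ν := volume.restrict S)
    (f := fun (z : ℝ × ℝ) (ξ : ℝ) => Complex.exp
      (Complex.I * (ξ * z.1 + ((μ * ξ ^ 3 + κ * ξ ^ 2 : ℝ) : ℂ) * z.2)) * f ξ)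
    (Measurable.stronglyMeasurable (by fun_prop))).aestronglyMeasurable

theorem eLpNorm_cubicExtension_le {μ : ℝ} (hμ : μ ≠ 0) :
    ∃ K : ℝ≥0, ∀ (κ : ℝ) (S : Set ℝ), MeasurableSet S →
      (∀ ξ ∈ S, ∀ η ∈ S, 3 * |μ| * |ξ - η| ≤ |3 * μ * (ξ + η) + 2 * κ|) →
      ∀ f : ℝ → ℂ, Measurable f → Integrable f →
        eLpNorm (cubicExtension μ κ S f) 8 volume ≤ K * eLpNorm f 2 volume := by
  obtain ⟨K, hK⟩ := lintegral_cubicExtension_le hμ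
  refine ⟨K ^ (1 / 8 : ℝ), fun κ S hSm hS f hfm hf => ?_⟩
  rw [eLpNorm_eq_lintegral_rpow_enorm_toReal (by norm_num) (by norm_num),
    eLpNorm_eq_lintegral_rpow_enorm_toReal (by norm_num) (by norm_num)]
  have h8 : (8 : ℝ≥0∞).toReal = (8 : ℕ) := by norm_num
  have h2 : (2 : ℝ≥0∞).toReal = (2 : ℕ) := by norm_num
  simp_rw [h8, h2, ENNReal.rpow_natCast]
  calc _ ≤ ((K : ℝ≥0∞) * (∫⁻ x, ‖f x‖ₑ ^ 2) ^ 4) ^ (1 / 8 : ℝ) := by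
        push_cast
        gcongr
        exact hK κ S hSm hS f hfm hf
    _ = _ := by
        rw [ENNReal.mul_rpow_of_nonneg _ _ (by norm_num), ← ENNReal.rpow_natCast,
          ← ENNReal.rpow_mul, ENNReal.coe_rpow_of_nonneg _ (by norm_num)]
        norm_num

theorem FT_eq_fourier (f : ℝ → ℂ) (ξ : ℝ) : FT f ξ = 𝓕 f ((2 * π)⁻¹ * ξ) := by
  rw [Real.fourier_eq', FT]
  refine integral_congr_ae (Filter.Eventually.of_forall fun x => ?_)
  simp only [smul_eq_mul]
  congr 2
  have : (π : ℂ) ≠ 0 := by exact_mod_cast pi_ne_zero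
  simp
  field_simp

theorem continuous_FT (u : SchwartzMap ℝ ℂ) : Continuous (FT u) := by
  rw [funext (FT_eq_fourier u)]
  exact (continuous_fourier u.integrable).comp (by fun_prop)

theorem integrable_FT (u : SchwartzMap ℝ ℂ) : Integrable (FT u) := by
  rw [funext (FT_eq_fourier u), ← SchwartzMap.fourier_coe]
  exact (𝓕 u).integrable.comp_mul_left' (by positivity)

theorem eLpNorm_FT_le (u : SchwartzMap ℝ ℂ) :
    eLpNorm (FT u) 2 volume ≤ ENNReal.ofReal (2 * π) ^ (1 / 2 : ℝ) * eLpNorm u 2 volume := by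
  rw [eLpNorm_eq_lintegral_rpow_enorm_toReal (by norm_num) (by norm_num),
    eLpNorm_eq_lintegral_rpow_enorm_toReal (by norm_num) (by norm_num)]
  have h2 : (2 : ℝ≥0∞).toReal = (2 : ℕ) := by norm_num
  simp_rw [h2, ENNReal.rpow_natCast]
  push_cast
  rw [← ENNReal.mul_rpow_of_nonneg _ _ (by norm_num)]
  gcongr
  have hl := lintegral_map (μ := volume) (f := fun ξ => ‖𝓕 (u : ℝ → ℂ) ξ‖ₑ ^ 2)
    (g := fun ξ : ℝ => (2 * π)⁻¹ * ξ)
    ((continuous_fourier u.integrable).measurable.enorm.pow_const 2) (by fun_prop)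
  simp_rw [FT_eq_fourier]
  rw [← hl, Real.map_volume_mul_left (by positivity), lintegral_smul_measure, inv_inv,
    abs_of_pos (by positivity), smul_eq_mul]
  exact mul_le_mul_right (lintegral_enorm_fourier_sq_le u.integrable) _

theorem Sgrp_eq_sum_cubicExtension (ν μ : ℝ) (u : SchwartzMap ℝ ℂ) (z : ℝ × ℝ) :
    Sgrp ν μ u z.1 z.2 = (2 * π)⁻¹ •
      ((cubicExtension μ (-ν) (Set.Ici 0 ∩ Set.Ici (ν / (3 * μ))) (FT u) z +
          cubicExtension μ (-ν) (Set.Ici 0 \ Set.Ici (ν / (3 * μ))) (FT u) z) +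
        (cubicExtension μ ν ((Set.Ici 0)ᶜ ∩ Set.Ici (-(ν / (3 * μ)))) (FT u) z +
          cubicExtension μ ν ((Set.Ici 0)ᶜ \ Set.Ici (-(ν / (3 * μ)))) (FT u) z)) := by
  set h : ℝ → ℂ := fun ξ =>
    Complex.exp (Complex.I * (ξ * z.1 + phase ν μ ξ * z.2)) * FT u ξ with hh
  have hi : Integrable h := by
    refine (integrable_FT u).bdd_mul (c := 1)
      (Continuous.aestronglyMeasurable (by unfold phase; fun_prop))
      (Filter.Eventually.of_forall fun ξ => ?_)
    rw [mul_comm Complex.I]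
    exact_mod_cast (Complex.norm_exp_ofReal_mul_I _).le
  have hpos : ∀ S ⊆ Set.Ici (0 : ℝ), MeasurableSet S →
      cubicExtension μ (-ν) S (FT u) z = ∫ ξ in S, h ξ := by
    intro S hS hSm
    refine setIntegral_congr_fun hSm fun ξ hξ => ?_
    have : phase ν μ ξ = μ * ξ ^ 3 + -ν * ξ ^ 2 := by
      rw [phase, abs_of_nonneg (hS hξ)]; ring
    simp only [hh, this]
  have hneg : ∀ S ⊆ (Set.Ici (0 : ℝ))ᶜ, MeasurableSet S →
      cubicExtension μ ν S (FT u) z = ∫ ξ in S, h ξ := by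
    intro S hS hSm
    refine setIntegral_congr_fun hSm fun ξ hξ => ?_
    have hξ0 : ξ < 0 := not_le.1 (hS hξ)
    have : phase ν μ ξ = μ * ξ ^ 3 + ν * ξ ^ 2 := by
      rw [phase, abs_of_neg hξ0]; ring
    simp only [hh, this]
  rw [hpos _ Set.inter_subset_left (measurableSet_Ici.inter measurableSet_Ici),
    hpos _ Set.sdiff_subset (measurableSet_Ici.diff measurableSet_Ici),
    hneg _ Set.inter_subset_left (measurableSet_Ici.compl.inter measurableSet_Ici),
    hneg _ Set.sdiff_subset (measurableSet_Ici.compl.diff measurableSet_Ici),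
    integral_inter_add_sdiff measurableSet_Ici hi.integrableOn,
    integral_inter_add_sdiff measurableSet_Ici hi.integrableOn,
    integral_add_compl measurableSet_Ici hi]
  rfl

end Splitting

/-- **Lemma 2.1, estimate (2.5)** (`L⁸` Strichartz estimate for the Benjamin group):
there is `C > 0`, depending only on `ν` and `μ`, such that for every Schwartz
datum `u₀` one has `‖S(t)u₀‖_{L⁸_{xt}(ℝ²)} ≤ C ‖u₀‖_{L²}`. -/
theorem benjamin_L8_strichartz (ν μ : ℝ) (hμ : μ ≠ 0) :
    ∃ C > (0 : ℝ), ∀ u₀ : SchwartzMap ℝ ℂ,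
      eLpNorm (fun z : ℝ × ℝ => Sgrp ν μ (fun x => u₀ x) z.1 z.2) 8
          (volume : Measure (ℝ × ℝ)) ≤
        ENNReal.ofReal C * eLpNorm (fun x => u₀ x) 2 volume := by
  obtain ⟨K, hK⟩ := eLpNorm_cubicExtension_le hμ
  set B : ℝ≥0 := K * (2 * π).toNNReal ^ (1 / 2 : ℝ)
  set A : ℝ≥0 := ‖(2 * π)⁻¹‖₊ * (4 * B)
  refine ⟨A + 1, by positivity, fun u => ?_⟩
  have hm := (continuous_FT u).measurable
  have hpiece : ∀ (κ c : ℝ) (S : Set ℝ), 3 * μ * c + κ = 0 → MeasurableSet S →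
      S ⊆ Set.Ici c ∨ S ⊆ Set.Iic c → eLpNorm (cubicExtension μ κ S (FT u)) 8 volume ≤
        B * eLpNorm u 2 volume := by
    intro κ c S hc hS hcS
    refine (hK κ S hS (three_mul_abs_mul_abs_sub_le hc hcS) _ hm (integrable_FT u)).trans ?_
    refine (mul_le_mul_right (eLpNorm_FT_le u) _).trans (le_of_eq ?_)
    rw [ENNReal.coe_mul, ENNReal.coe_rpow_of_nonneg _ (by norm_num), mul_assoc]
    rfl
  have hsub : ∀ (S : Set ℝ) (c : ℝ), S \ Set.Ici c ⊆ Set.Iic c :=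
    fun S c ξ hξ => Set.mem_Iic.2 (not_le.1 hξ.2).le
  have hc1 : 3 * μ * (ν / (3 * μ)) + -ν = 0 := by field_simp; ring
  have hc2 : 3 * μ * (-(ν / (3 * μ))) + ν = 0 := by field_simp; ring
  have hS0 : MeasurableSet (Set.Ici (0 : ℝ)) := measurableSet_Ici
  have h1 := hpiece (-ν) _ (Set.Ici 0 ∩ Set.Ici (ν / (3 * μ))) hc1 (hS0.inter measurableSet_Ici)
    (Or.inl Set.inter_subset_right)
  have h2 := hpiece (-ν) _ (Set.Ici 0 \ Set.Ici (ν / (3 * μ))) hc1 (hS0.diff measurableSet_Ici)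
    (Or.inr (hsub _ _))
  have h3 := hpiece ν _ ((Set.Ici 0)ᶜ ∩ Set.Ici (-(ν / (3 * μ)))) hc2
    (hS0.compl.inter measurableSet_Ici) (Or.inl Set.inter_subset_right)
  have h4 := hpiece ν _ ((Set.Ici 0)ᶜ \ Set.Ici (-(ν / (3 * μ)))) hc2
    (hS0.compl.diff measurableSet_Ici) (Or.inr (hsub _ _))
  have hae := fun κ S => aestronglyMeasurable_cubicExtension μ κ S hm
  have hS : (fun z : ℝ × ℝ => Sgrp ν μ (fun x => u x) z.1 z.2) = (2 * π)⁻¹ •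
      ((cubicExtension μ (-ν) (Set.Ici 0 ∩ Set.Ici (ν / (3 * μ))) (FT u) +
          cubicExtension μ (-ν) (Set.Ici 0 \ Set.Ici (ν / (3 * μ))) (FT u)) +
        (cubicExtension μ ν ((Set.Ici 0)ᶜ ∩ Set.Ici (-(ν / (3 * μ)))) (FT u) +
          cubicExtension μ ν ((Set.Ici 0)ᶜ \ Set.Ici (-(ν / (3 * μ)))) (FT u))) :=
    funext (Sgrp_eq_sum_cubicExtension ν μ u)
  rw [hS, eLpNorm_const_smul]
  calc _ ≤ ‖(2 * π)⁻¹‖ₑ * ((B * eLpNorm u 2 volume + B * eLpNorm u 2 volume) +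
        (B * eLpNorm u 2 volume + B * eLpNorm u 2 volume)) := by
        gcongr
        refine (eLpNorm_add_le ((hae _ _).add (hae _ _)) ((hae _ _).add (hae _ _))
          (by norm_num)).trans (add_le_add ?_ ?_)
        · exact (eLpNorm_add_le (hae _ _) (hae _ _) (by norm_num)).trans (add_le_add h1 h2)
        · exact (eLpNorm_add_le (hae _ _) (hae _ _) (by norm_num)).trans (add_le_add h3 h4)
    _ = (A : ℝ≥0∞) * eLpNorm u 2 volume := by
        simp only [A, ENNReal.coe_mul, enorm_eq_nnnorm, ENNReal.coe_ofNat]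
        ring
    _ ≤ _ := by
        gcongr
        rw [← ENNReal.ofReal_coe_nnreal]
        exact ENNReal.ofReal_le_ofReal (by linarith)
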